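/- For n ≥ 9, the maximum number of edges in a connected n-vertex P³₃-free 3-graph containing a copy of C³₃ is exactly 3n - 8. -/

import Mathlib

/-- `H` contains a copy of the 3-uniform linear path `P³₃`. -/
def HasP33 {V : Type*} [DecidableEq V] (H : Finset (Finset V)) : Prop :=
  ∃ e₁ e₂ e₃, e₁ ∈ H ∧ e₂ ∈ H ∧ e₃ ∈ H ∧
    (e₁ ∩ e₂).card = 1 ∧ (e₂ ∩ e₃).card = 1 ∧ e₁ ∩ e₃ = ∅

/-- `H` contains a copy of the 3-uniform triangle `C³₃`. -/
def HasC33 {V : Type*} [DecidableEq V] (H : Finset (Finset V)) : Prop :=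
  ∃ a b c d e f : V, ({a, b, c, d, e, f} : Finset V).card = 6 ∧
    ({a, b, c} : Finset V) ∈ H ∧ ({c, d, e} : Finset V) ∈ H ∧ ({e, f, a} : Finset V) ∈ H

namespace CT

/-- the three edges of the triangle -/
def Cs : Fin 3 → Finset (Fin 6) := ![{0, 1, 2}, {2, 3, 4}, {4, 5, 0}]

/-- the admissible pairs -/
def net : Fin 6 → Finset (Fin 6) := ![{0, 2}, {2, 4}, {4, 0}, {0, 3}, {2, 5}, {4, 1}]

/-- triples containing 0 -/
def tr : Fin 10 → Finset (Fin 6) :=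
  ![{0, 1, 2}, {0, 1, 3}, {0, 1, 4}, {0, 1, 5}, {0, 2, 3}, {0, 2, 4}, {0, 2, 5}, {0, 3, 4},
    {0, 3, 5}, {0, 4, 5}]

/-- `ns k i`: the complementary pair of triples number `k` is compatible with the pair `i` -/
def ns (k : Fin 10) (i : Fin 6) : Bool :=
  decide ((net i ⊆ tr k ∨ net i ⊆ (tr k)ᶜ) ∧ ¬ (k = 5 ∧ i < 3))

/-- disjointness of the pairs -/
def dj (i j : Fin 6) : Bool := decide (net i ∩ net j = ∅)

def cnt (A : Fin 6 → Bool) : ℕ := (Finset.univ.filter (fun i => A i = true)).card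

def dd (A : Fin 6 → Bool) : ℕ :=
  (Finset.univ.filter (fun k : Fin 10 => ∀ i, A i = true → ns k i = true)).card

def bigB (A B : Fin 6 → Bool) : Bool :=
  decide ((∀ i j, A i = true → B j = true → dj i j = false) → 0 < cnt A → 0 < cnt B →
    (4 ≤ cnt A → cnt A ≤ 5 ∧ cnt B ≤ 2) ∧ (3 ≤ cnt A → dd (fun i => A i || B i) = 0) ∧
    (2 ≤ cnt A → dd (fun i => A i || B i) ≤ 1) ∧ dd (fun i => A i || B i) ≤ 4)

def bigC (A : Fin 6 → Bool) : Bool :=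
  decide (∀ b0 b1 b2 b3 b4 b5 : Bool, bigB A ![b0, b1, b2, b3, b4, b5] = true)

theorem big0 : ∀ a0 a1 a2 a3 a4 a5 : Bool, bigC ![a0, a1, a2, a3, a4, a5] = true := by
  decide +kernel

theorem eta6 (A : Fin 6 → Bool) : A = ![A 0, A 1, A 2, A 3, A 4, A 5] := by
  funext i; fin_cases i <;> rfl

theorem big (A B : Fin 6 → Bool) (h : ∀ i j, A i = true → B j = true → dj i j = false)
    (hA : 0 < cnt A) (hB : 0 < cnt B) :
    (4 ≤ cnt A → cnt A ≤ 5 ∧ cnt B ≤ 2) ∧ (3 ≤ cnt A → dd (fun i => A i || B i) = 0) ∧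
    (2 ≤ cnt A → dd (fun i => A i || B i) ≤ 1) ∧ dd (fun i => A i || B i) ≤ 4 := by
  have h1 := big0 (A 0) (A 1) (A 2) (A 3) (A 4) (A 5)
  rw [← eta6 A] at h1
  have h2 := of_decide_eq_true h1 (B 0) (B 1) (B 2) (B 3) (B 4) (B 5)
  rw [← eta6 B] at h2
  exact of_decide_eq_true h2 h hA hB

theorem dd_anti (A B : Fin 6 → Bool) (h : ∀ i, A i = true → B i = true) : dd B ≤ dd A := by
  apply Finset.card_le_card
  intro k hk
  simp only [Finset.mem_filter, Finset.mem_univ, true_and] at hk ⊢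
  exact fun i hi => hk i (h i hi)

/-- the optimisation step -/
theorem opt {W : Type*} [DecidableEq W] (S : Finset W) (hS : 3 ≤ S.card) (L : W → Fin 6 → Bool)
    (G : Fin 6 → Bool) (hG : ∀ w ∈ S, ∀ i, L w i = true → G i = true)
    (hne : ∀ w ∈ S, 0 < cnt (L w))
    (hx : ∀ w ∈ S, ∀ w' ∈ S, w ≠ w' → ∀ i j, L w i = true → L w' j = true → dj i j = false) :
    ∑ w ∈ S, cnt (L w) + dd G ≤ 3 * S.card := by
  obtain ⟨w0, hw0, hmax⟩ := S.exists_max_image (fun w => cnt (L w))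
    (Finset.card_pos.1 (by omega))
  have hcard : (S.erase w0).card = S.card - 1 := Finset.card_erase_of_mem hw0
  obtain ⟨w1, hw1⟩ : (S.erase w0).Nonempty := Finset.card_pos.1 (by omega)
  have hb : ∀ w ∈ S.erase w0, _ := fun w hw =>
    big (L w0) (L w) (hx w0 hw0 w (Finset.mem_of_mem_erase hw) (Finset.ne_of_mem_erase hw).symm)
      (hne _ hw0) (hne _ (Finset.mem_of_mem_erase hw))
  have hd : dd G ≤ dd (fun i => L w0 i || L w1 i) := by
    apply dd_anti
    intro i hi
    rcases Bool.or_eq_true_iff.1 hi with h | h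
    · exact hG _ hw0 i h
    · exact hG _ (Finset.mem_of_mem_erase hw1) i h
  obtain ⟨c1, c2, c3, c4⟩ := hb w1 hw1
  rw [← Finset.add_sum_erase S _ hw0]
  have bound : ∀ K, (∀ w ∈ S.erase w0, cnt (L w) ≤ K) →
      ∑ w ∈ S.erase w0, cnt (L w) ≤ (S.card - 1) * K := by
    intro K hK
    rw [← hcard]
    simpa using Finset.sum_le_card_nsmul _ _ _ hK
  rcases Nat.lt_or_ge (cnt (L w0)) 4 with h4 | h4
  · have := bound (cnt (L w0)) (fun w hw => hmax w (Finset.mem_of_mem_erase hw))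
    have h0 := hne _ hw0
    generalize cnt (L w0) = c at *
    interval_cases c <;> omega
  · have := bound 2 (fun w hw => ((hb w hw).1 h4).2)
    have := (c1 h4).1
    have := c2 (by omega)
    omega

section
variable {n : ℕ} (φ : Fin 6 ↪ Fin n)

/-- trace on the triangle -/
def tc (e : Finset (Fin n)) : Finset (Fin 6) := Finset.univ.filter (fun i => φ i ∈ e)

/-- part outside of the triangle -/
def ou (e : Finset (Fin n)) : Finset (Fin n) := e \ Finset.univ.map φ

theorem decomp (e : Finset (Fin n)) : e = (tc φ e).map φ ∪ ou φ e := by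
  ext v
  simp only [tc, ou, Finset.mem_union, Finset.mem_map, Finset.mem_filter, Finset.mem_univ,
    true_and, Finset.mem_sdiff]
  constructor
  · intro h
    by_cases h' : ∃ a, φ a = v
    · obtain ⟨a, rfl⟩ := h'
      exact Or.inl ⟨a, h, rfl⟩
    · exact Or.inr ⟨h, h'⟩
  · rintro (⟨a, h, rfl⟩ | h)
    · exact h
    · exact h.1

theorem tc_inter (e f : Finset (Fin n)) : tc φ (e ∩ f) = tc φ e ∩ tc φ f := by
  ext; simp [tc]

theorem ou_inter (e f : Finset (Fin n)) : ou φ (e ∩ f) = ou φ e ∩ ou φ f := by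
  ext; simp [ou]; tauto

theorem card_dec (e : Finset (Fin n)) : e.card = (tc φ e).card + (ou φ e).card := by
  conv_lhs => rw [decomp φ e]
  rw [Finset.card_union_of_disjoint, Finset.card_map]
  rw [Finset.disjoint_left]
  intro v hv hv'
  simp only [ou, Finset.mem_sdiff, Finset.mem_map, Finset.mem_univ, true_and] at hv hv'
  obtain ⟨a, _, rfl⟩ := hv
  exact hv'.2 ⟨a, rfl⟩

theorem card_inter (e f : Finset (Fin n)) :
    (e ∩ f).card = (tc φ e ∩ tc φ f).card + (ou φ e ∩ ou φ f).card := by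
  rw [card_dec φ, tc_inter, ou_inter]

theorem tc_map (P : Finset (Fin 6)) : tc φ (P.map φ) = P := by
  ext; simp [tc]

theorem ou_map (P : Finset (Fin 6)) : ou φ (P.map φ) = ∅ := by
  ext; simp [ou]; grind

theorem tc_ins (w : Fin n) (hw : w ∉ Finset.univ.map φ) (P : Finset (Fin 6)) :
    tc φ (insert w (P.map φ)) = P := by
  ext i
  simp only [Finset.mem_map, Finset.mem_univ, true_and, not_exists] at hw
  simp [tc, hw i]

theorem ou_ins (w : Fin n) (hw : w ∉ Finset.univ.map φ) (P : Finset (Fin 6)) :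
    ou φ (insert w (P.map φ)) = {w} := by
  rw [ou, Finset.insert_sdiff_of_notMem _ hw]
  have := ou_map φ P
  rw [ou] at this
  rw [this]
  rfl

theorem mkP (H : Finset (Finset (Fin n))) (hP : ¬ HasP33 H) (e f g : Finset (Fin n))
    (he : e ∈ H) (hf : f ∈ H) (hg : g ∈ H)
    (h1 : (tc φ e ∩ tc φ f).card + (ou φ e ∩ ou φ f).card = 1)
    (h2 : (tc φ f ∩ tc φ g).card + (ou φ f ∩ ou φ g).card = 1)
    (h3 : (tc φ e ∩ tc φ g).card + (ou φ e ∩ ou φ g).card = 0) : False := by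
  rw [← card_inter] at h1 h2 h3
  exact hP ⟨e, f, g, he, hf, hg, h1, h2, Finset.card_eq_zero.1 h3⟩

end

theorem fin1 : ∀ P : Finset (Fin 6), P.card = 1 ∨ (P.card = 2 ∧ ∀ i, net i ≠ P) →
    ∃ k l, (P ∩ Cs k).card = 1 ∧ (Cs k ∩ Cs l).card = 1 ∧ (P ∩ Cs l).card = 0 := by
  decide +kernel

theorem fin2 : ∀ i, ∃ k, (net i ∩ Cs k).card = 1 := by decide +kernel

theorem fin3 : ∀ i j, dj i j = true → (net i ∩ net j).card = 0 ∧
    ∃ k, (net i ∩ Cs k).card = 1 ∧ (Cs k ∩ net j).card = 1 := by decide +kernel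

theorem fin4 : ∀ k i, ns k i = false →
    ((tr k ∩ net i).card = 1 ∧ (net i ∩ (tr k)ᶜ).card = 1) ∨
    ∃ l, ((tr k)ᶜ ∩ Cs l).card = 1 ∧ (Cs l ∩ net i).card = 1 ∧ ((tr k)ᶜ ∩ net i).card = 0 := by
  decide +kernel

theorem fin5 : ∀ T : Finset (Fin 6), T.card = 3 → ∃ k, T = tr k ∨ T = (tr k)ᶜ := by
  decide +kernel

theorem fin6 : ∀ k, ((tr k) ∩ (tr k)ᶜ).card = 0 := by decide +kernel

theorem upper {n : ℕ} (hn : 9 ≤ n) (φ : Fin 6 ↪ Fin n) (H : Finset (Finset (Fin n)))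
    (h3 : ∀ e ∈ H, e.card = 3) (hP : ¬ HasP33 H) (hC : ∀ k, (Cs k).map φ ∈ H)
    (hconn : ∀ u v : Fin n,
      Relation.ReflTransGen (fun a b => ∃ e ∈ H, a ∈ e ∧ b ∈ e) u v) :
    H.card ≤ 3 * n - 8 := by
  classical
  have hPm := mkP φ H hP
  -- traces of size one, and bad pairs
  have hA : ∀ e ∈ H, (tc φ e).card ≠ 1 ∧ ((tc φ e).card = 2 → ∃ i, net i = tc φ e) := by
    intro e he
    by_contra hcon
    have : (tc φ e).card = 1 ∨ ((tc φ e).card = 2 ∧ ∀ i, net i ≠ tc φ e) := by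
      by_contra h'; apply hcon; push Not at h'; exact h'
    obtain ⟨k, l, q1, q2, q3⟩ := fin1 _ this
    exact hPm e _ _ he (hC k) (hC l) (by simp [tc_map, ou_map, q1]) (by simp [tc_map, ou_map, q2])
      (by rw [tc_map, ou_map, q3]; simp)
  have hcd : ∀ e ∈ H, (tc φ e).card + (ou φ e).card = 3 := fun e he => by
    rw [← card_dec, h3 e he]
  have hB1 : ∀ v, ∀ e ∈ H, ∀ e' ∈ H, v ∉ Finset.univ.map φ → v ∈ e → v ∈ e' → tc φ e = ∅ →
      2 ≤ (tc φ e').card → False := by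
    intro v e he e' he' hv hve hve' h0 h2
    have hve1 : v ∈ ou φ e := Finset.mem_sdiff.2 ⟨hve, hv⟩
    have hve2 : v ∈ ou φ e' := Finset.mem_sdiff.2 ⟨hve', hv⟩
    have hpos := Finset.card_pos.2 ⟨v, hve2⟩
    have hs := hcd e' he'
    obtain ⟨w, hw⟩ := Finset.card_eq_one.1 (show (ou φ e').card = 1 by omega)
    rw [hw, Finset.mem_singleton] at hve2
    subst hve2
    obtain ⟨i, hi⟩ := (hA e' he').2 (by omega)
    obtain ⟨k, hk⟩ := fin2 i
    refine hPm e e' _ he he' (hC k) ?_ ?_ ?_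
    · rw [h0, hw, Finset.inter_singleton_of_mem hve1]; simp
    · rw [tc_map, ou_map, ← hi, hk]; simp
    · rw [h0, ou_map]; simp
  have hcover : ∀ v, v ∈ Finset.univ.map φ ∨ ∃ e ∈ H, v ∈ e ∧ 2 ≤ (tc φ e).card := by
    intro v
    have := hconn (φ 0) v
    induction this with
    | refl => left; simp
    | @tail b c _ hs ih =>
      obtain ⟨e, he, hbe, hce⟩ := hs
      by_cases h2 : 2 ≤ (tc φ e).card
      · exact Or.inr ⟨e, he, hce, h2⟩
      · have h1 := (hA e he).1
        have h0 : tc φ e = ∅ := Finset.card_eq_zero.1 (by omega)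
        by_cases hb : b ∈ Finset.univ.map φ
        · exfalso
          simp only [Finset.mem_map, Finset.mem_univ, true_and] at hb
          obtain ⟨i, rfl⟩ := hb
          have : i ∈ tc φ e := by simp [tc, hbe]
          rw [h0] at this
          simp at this
        · rcases ih with ih | ⟨e', he', hbe', h2'⟩
          · exact absurd ih hb
          · exact (hB1 b e he e' he' hb hbe hbe' h0 h2').elim
  have hB : ∀ e ∈ H, 2 ≤ (tc φ e).card := by
    intro e he
    by_contra hlt
    have h1 := (hA e he).1
    have h0 : tc φ e = ∅ := Finset.card_eq_zero.1 (by omega)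
    have hs := hcd e he
    obtain ⟨v, hv⟩ := Finset.card_pos.1 (show 0 < (ou φ e).card by omega)
    obtain ⟨hv1, hv2⟩ := Finset.mem_sdiff.1 hv
    rcases hcover v with h | ⟨e', he', hve', h2'⟩
    · exact hv2 h
    · exact hB1 v e he e' he' hv2 hv1 hve' h0 h2'
  set S : Finset (Fin n) := (Finset.univ.map φ)ᶜ with hSdef
  have hScard : S.card = n - 6 := by
    rw [hSdef, Finset.card_compl, Finset.card_map]; simp
  let L : Fin n → Fin 6 → Bool := fun w i => decide (insert w ((net i).map φ) ∈ H)
  let G : Fin 6 → Bool := fun i => decide (∃ w ∈ S, insert w ((net i).map φ) ∈ H)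
  -- description of the outer edges
  have hout : ∀ e ∈ H, ∀ v ∈ e, v ∉ Finset.univ.map φ →
      ∃ i, insert v ((net i).map φ) ∈ H ∧ e = insert v ((net i).map φ) := by
    intro e he v hve hv
    have hve2 : v ∈ ou φ e := Finset.mem_sdiff.2 ⟨hve, hv⟩
    have hpos := Finset.card_pos.2 ⟨v, hve2⟩
    have hs := hcd e he
    have hb := hB e he
    obtain ⟨w, hw⟩ := Finset.card_eq_one.1 (show (ou φ e).card = 1 by omega)
    rw [hw, Finset.mem_singleton] at hve2
    subst hve2
    obtain ⟨i, hi⟩ := (hA e he).2 (by omega)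
    have heq : e = insert v ((net i).map φ) := by
      conv_lhs => rw [decomp φ e, hw, ← hi]
      rw [Finset.union_comm]; rfl
    exact ⟨i, heq ▸ he, heq⟩
  have hopt := opt S (by omega) L G
    (by
      intro w hw i hi
      simp only [L, G, decide_eq_true_eq] at hi ⊢
      exact ⟨w, hw, hi⟩)
    (by
      intro w hw
      rw [hSdef, Finset.mem_compl] at hw
      rcases hcover w with h | ⟨e, he, hwe, _⟩
      · exact absurd h hw
      · obtain ⟨i, hi, _⟩ := hout e he w hwe hw
        exact Finset.card_pos.2 ⟨i, by simp [L, hi]⟩)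
    (by
      intro w hw w' hw' hne i j hi hj
      rw [hSdef, Finset.mem_compl] at hw hw'
      simp only [L, decide_eq_true_eq] at hi hj
      by_contra hd
      rw [Bool.not_eq_false] at hd
      obtain ⟨q0, k, q1, q2⟩ := fin3 i j hd
      refine hPm _ _ _ hi (hC k) hj ?_ ?_ ?_
      · rw [tc_ins φ w hw, tc_map, ou_map, q1]; simp
      · rw [tc_ins φ w' hw', tc_map, ou_map, q2]; simp
      · rw [tc_ins φ w hw, tc_ins φ w' hw', ou_ins φ w hw, ou_ins φ w' hw', q0]
        simp [hne])
  -- counting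
  let F1 : Finset (Fin 10) := Finset.univ.filter (fun k => (tr k).map φ ∈ H)
  let F2 : Finset (Fin 10) := Finset.univ.filter (fun k => ((tr k)ᶜ).map φ ∈ H)
  have hsub : H ⊆ (F1.image (fun k => (tr k).map φ) ∪ F2.image (fun k => ((tr k)ᶜ).map φ)) ∪
      S.biUnion (fun w => (Finset.univ.filter (fun i => L w i = true)).image
        (fun i => insert w ((net i).map φ))) := by
    intro e he
    rw [Finset.mem_union, Finset.mem_union]
    by_cases ho : ou φ e = ∅
    · left
      have hs := hcd e he
      rw [ho] at hs
      have hd := decomp φ e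
      rw [ho, Finset.union_empty] at hd
      obtain ⟨k, hk | hk⟩ := fin5 (tc φ e) (by simpa using hs)
      · left
        rw [hk] at hd
        exact Finset.mem_image.2 ⟨k, by simp [F1, ← hd, he], hd.symm⟩
      · right
        rw [hk] at hd
        exact Finset.mem_image.2 ⟨k, Finset.mem_filter.2 ⟨Finset.mem_univ _, hd ▸ he⟩, hd.symm⟩
    · right
      obtain ⟨v, hv⟩ := Finset.nonempty_iff_ne_empty.2 ho
      obtain ⟨hv1, hv2⟩ := Finset.mem_sdiff.1 hv
      obtain ⟨i, hi, hei⟩ := hout e he v hv1 hv2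
      refine Finset.mem_biUnion.2 ⟨v, by rw [hSdef, Finset.mem_compl]; exact hv2,
        Finset.mem_image.2 ⟨i, by simp [L, hi], hei.symm⟩⟩
  have hc1 := Finset.card_le_card hsub
  have hc2 := hc1.trans (Finset.card_union_le _ _)
  have hc3 := Finset.card_union_le (F1.image (fun k => (tr k).map φ))
    (F2.image (fun k => ((tr k)ᶜ).map φ))
  have hc4 : (F1.image (fun k => (tr k).map φ)).card ≤ F1.card := Finset.card_image_le
  have hc5 : (F2.image (fun k => ((tr k)ᶜ).map φ)).card ≤ F2.card := Finset.card_image_le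
  have hc6 : (S.biUnion (fun w => (Finset.univ.filter (fun i => L w i = true)).image
        (fun i => insert w ((net i).map φ)))).card ≤ ∑ w ∈ S, cnt (L w) :=
    Finset.card_biUnion_le.trans (Finset.sum_le_sum fun w _ => Finset.card_image_le)
  have hc7 := Finset.card_union_add_card_inter F1 F2
  have hc8 : (F1 ∪ F2).card ≤ 10 := by simpa using Finset.card_le_univ (F1 ∪ F2)
  have hc9 : (F1 ∩ F2).card ≤ dd G := by
    apply Finset.card_le_card
    intro k hk
    simp only [F1, F2, Finset.mem_inter, Finset.mem_filter, Finset.mem_univ, true_and] at hk ⊢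
    intro i hi
    simp only [G, decide_eq_true_eq] at hi
    obtain ⟨w, hw, hi⟩ := hi
    rw [hSdef, Finset.mem_compl] at hw
    by_contra hcon
    rw [Bool.not_eq_true] at hcon
    rcases fin4 k i hcon with ⟨q1, q2⟩ | ⟨l, q1, q2, q3⟩
    · refine hPm _ _ _ hk.1 hi hk.2 ?_ ?_ ?_
      · rw [tc_ins φ w hw, tc_map, ou_map, q1]; simp
      · rw [tc_ins φ w hw, tc_map, ou_map, q2]; simp
      · rw [tc_map, tc_map, ou_map, fin6]; simp
    · refine hPm _ _ _ hk.2 (hC l) hi ?_ ?_ ?_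
      · rw [tc_map, tc_map, ou_map, q1]; simp
      · rw [tc_ins φ w hw, tc_map, ou_map, q2]; simp
      · rw [tc_ins φ w hw, tc_map, ou_map, q3]; simp
  omega

theorem lower (n : ℕ) (hn : 9 ≤ n) : ∃ H : Finset (Finset (Fin n)),
      (∀ e ∈ H, e.card = 3) ∧ ¬ HasP33 H ∧ HasC33 H ∧
      (∀ u v : Fin n, Relation.ReflTransGen (fun a b => ∃ e ∈ H, a ∈ e ∧ b ∈ e) u v) ∧
      H.card = 3 * n - 8 := by
  classical
  obtain ⟨m, rfl⟩ : ∃ m, n = m + 9 := ⟨n - 9, by omega⟩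
  let f : ℕ → Fin (m + 9) := fun i => Fin.ofNat (m + 9) i
  have hf : ∀ i j, i < 9 → j < 9 → (f i = f j ↔ i = j) := by
    intro i j hi hj
    simp only [f, Fin.ext_iff, Fin.val_ofNat]
    rw [Nat.mod_eq_of_lt (by omega), Nat.mod_eq_of_lt (by omega)]
  let X : Finset (Fin (m + 9)) := {f 0, f 1, f 2}
  have hX : X.card = 3 := by
    simp [X, Finset.card_eq_three]
    exact ⟨f 0, f 1, by simp [hf], f 2, by simp [hf], by simp [hf], rfl⟩
  let H1 := (X.powersetCard 2 ×ˢ Xᶜ).image (fun p => insert p.2 p.1)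
  have hmem : ∀ p : Finset (Fin (m + 9)) × Fin (m + 9), p ∈ X.powersetCard 2 ×ˢ Xᶜ →
      p.1 ⊆ X ∧ p.1.card = 2 ∧ p.2 ∉ X := by
    intro p hp
    simpa [Finset.mem_product, Finset.mem_powersetCard, and_assoc] using hp
  have hH : ∀ e ∈ insert X H1, e.card = 3 ∧ 2 ≤ (e ∩ X).card := by
    intro e he
    rcases Finset.mem_insert.1 he with rfl | he
    · simp [hX]
    · obtain ⟨p, hp, rfl⟩ := Finset.mem_image.1 he
      obtain ⟨q1, q2, q3⟩ := hmem p hp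
      refine ⟨?_, ?_⟩
      · rw [Finset.card_insert_of_notMem (fun h => q3 (q1 h)), q2]
      · rw [← q2]
        exact Finset.card_le_card (Finset.subset_inter (Finset.subset_insert _ _) q1)
  have hin : ∀ i j w, i < 3 → j < 3 → i ≠ j → w ∉ X → {f i, f j, w} ∈ insert X H1 := by
    intro i j w hi hj hij hw
    refine Finset.mem_insert_of_mem (Finset.mem_image.2 ⟨({f i, f j}, w), ?_, ?_⟩)
    · rw [Finset.mem_product, Finset.mem_powersetCard]
      refine ⟨⟨?_, ?_⟩, by simpa using hw⟩
      · intro x hx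
        simp only [Finset.mem_insert, Finset.mem_singleton] at hx
        rcases hx with rfl | rfl
        · interval_cases i <;> simp [X]
        · interval_cases j <;> simp [X]
      · exact Finset.card_pair (by rw [Ne, hf _ _ (by omega) (by omega)]; exact hij)
    · ext x; simp; tauto
  have hfX : ∀ i, 3 ≤ i → i < 9 → f i ∉ X := by
    intro i hi hi'
    simp only [X, Finset.mem_insert, Finset.mem_singleton]
    rw [hf _ _ hi' (by omega), hf _ _ hi' (by omega), hf _ _ hi' (by omega)]
    omega
  refine ⟨insert X H1, fun e he => (hH e he).1, ?_, ?_, ?_, ?_⟩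
  · rintro ⟨e1, e2, e3, h1, h2, h3, -, -, h0⟩
    have a1 := (hH e1 h1).2
    have a3 := (hH e3 h3).2
    have hdisj : Disjoint (e1 ∩ X) (e3 ∩ X) :=
      (Finset.disjoint_iff_inter_eq_empty.2 h0).mono Finset.inter_subset_left
        Finset.inter_subset_left
    have := Finset.card_union_of_disjoint hdisj
    have := Finset.card_le_card (Finset.union_subset (Finset.inter_subset_right (s₁ := e1))
      (Finset.inter_subset_right (s₁ := e3) (s₂ := X)))
    omega
  · refine ⟨f 0, f 3, f 1, f 4, f 2, f 5, ?_, ?_, ?_, ?_⟩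
    · have : ({f 0, f 3, f 1, f 4, f 2, f 5} : Finset (Fin (m + 9))) =
          ({0, 3, 1, 4, 2, 5} : Finset ℕ).image f := by simp
      rw [this, Finset.card_image_of_injOn]
      · rfl
      · intro x hx y hy hxy
        have hx' : x < 9 := by simp at hx; omega
        have hy' : y < 9 := by simp at hy; omega
        exact (hf x y hx' hy').1 hxy
    · rw [Finset.pair_comm]; exact hin 0 1 _ (by omega) (by omega) (by omega) (hfX 3 (by omega) (by omega))
    · rw [Finset.pair_comm]; exact hin 1 2 _ (by omega) (by omega) (by omega) (hfX 4 (by omega) (by omega))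
    · rw [Finset.pair_comm]; exact hin 2 0 _ (by omega) (by omega) (by omega) (hfX 5 (by omega) (by omega))
  · have key : ∀ v, ∃ e ∈ insert X H1, f 0 ∈ e ∧ v ∈ e := by
      intro v
      by_cases hv : v ∈ X
      · exact ⟨X, Finset.mem_insert_self _ _, by simp [X], hv⟩
      · exact ⟨_, hin 0 1 v (by omega) (by omega) (by omega) hv, by simp, by simp⟩
    intro u v
    obtain ⟨e, he, h1, h2⟩ := key u
    obtain ⟨e', he', h1', h2'⟩ := key v
    exact (Relation.ReflTransGen.single ⟨e, he, h2, h1⟩).tail ⟨e', he', h1', h2'⟩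
  · rw [Finset.card_insert_of_notMem, Finset.card_image_of_injOn, Finset.card_product,
      Finset.card_powersetCard, hX, Finset.card_compl, hX, Fintype.card_fin]
    · simp [Nat.choose]; omega
    · intro p hp q hq hpq
      obtain ⟨a1, a2, a3⟩ := hmem p hp
      obtain ⟨b1, b2, b3⟩ := hmem q hq
      simp only at hpq
      have e2 : p.2 = q.2 := by
        have : p.2 ∈ insert q.2 q.1 := hpq ▸ Finset.mem_insert_self _ _
        rcases Finset.mem_insert.1 this with h | h
        · exact h
        · exact absurd (b1 h) a3
      have e1 : p.1 = q.1 := by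
        rw [← Finset.erase_insert (fun h => a3 (a1 h)), hpq, e2,
          Finset.erase_insert (fun h => b3 (b1 h))]
      exact Prod.ext e1 e2
    · intro hXm
      obtain ⟨p, hp, hpX⟩ := Finset.mem_image.1 hXm
      exact (hmem p hp).2.2 (hpX ▸ Finset.mem_insert_self _ _)

end CT

theorem connected_conditional_turan (n : ℕ) (hn : 9 ≤ n) :
    IsGreatest {m : ℕ | ∃ H : Finset (Finset (Fin n)),
      (∀ e ∈ H, e.card = 3) ∧ ¬ HasP33 H ∧ HasC33 H ∧
      (∀ u v : Fin n, Relation.ReflTransGen (fun a b => ∃ e ∈ H, a ∈ e ∧ b ∈ e) u v) ∧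
      H.card = m} (3 * n - 8) := by
  refine ⟨CT.lower n hn, ?_⟩
  rintro m ⟨H, h3, hP, ⟨a, b, c, d, e, f, h6, hc1, hc2, hc3⟩, hconn, rfl⟩
  have himg : (Finset.univ.image ![a, b, c, d, e, f]).card = (Finset.univ : Finset (Fin 6)).card := by
    have : Finset.univ.image ![a, b, c, d, e, f] = {a, b, c, d, e, f} := by
      ext x; simp [Fin.exists_fin_succ, eq_comm]
    rw [this, h6]; rfl
  have hinj : Function.Injective ![a, b, c, d, e, f] := by
    have := Finset.card_image_iff.1 himg
    simpa [Set.injOn_univ] using this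
  refine CT.upper hn ⟨_, hinj⟩ H h3 hP ?_ hconn
  intro k
  fin_cases k
  · simpa [CT.Cs, Finset.map_insert] using hc1
  · simpa [CT.Cs, Finset.map_insert] using hc2
  · simpa [CT.Cs, Finset.map_insert] using hc3
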